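/- arXiv:1707.03648 — 10 statements merged into one kernel-verified Lean document; each statement's English description precedes it below -/
import Mathlib

section
/- For every finite cubic simple graph G = (V,E), the maximum over all orientations of G of the number of sources plus the number of sinks equals maxcut(G) − |V|/2; equivalently, 2·msso(G) = 2·maxcut(G) − |V|. -/
/-- An orientation of a simple graph `G`, encoded as a boolean function:
`o u v = true` means the edge `{u,v}` is oriented from `u` to `v`.
The condition requires that each edge gets exactly one of its two directions. -/
def IsOrientation {V : Type*} (G : SimpleGraph V) (o : V → V → Bool) : Prop :=
  ∀ u v, G.Adj u v → o u v = !o v u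

instance {V : Type*} [Fintype V] (G : SimpleGraph V) [DecidableRel G.Adj] :
    DecidablePred (IsOrientation G) := fun o =>
  inferInstanceAs (Decidable (∀ u v, G.Adj u v → o u v = !o v u))

/-- The number of sources plus the number of sinks of an orientation `o` of `G`.
A source is a vertex all of whose incident edges are oriented away from it;
a sink is a vertex all of whose incident edges are oriented towards it. -/
def sourceSinkCount {V : Type*} [Fintype V] [DecidableEq V]
    (G : SimpleGraph V) [DecidableRel G.Adj] (o : V → V → Bool) : ℕ :=
  (Finset.univ.filter fun v => ∀ u ∈ G.neighborFinset v, o v u = true).card +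
  (Finset.univ.filter fun v => ∀ u ∈ G.neighborFinset v, o v u = false).card

/-- `msso G`: the maximum, over all orientations of `G`, of the number of
sources plus the number of sinks. -/
noncomputable def msso {V : Type*} [Fintype V] [DecidableEq V]
    (G : SimpleGraph V) [DecidableRel G.Adj] : ℕ :=
  Finset.sup (Finset.univ.filter fun o : V → V → Bool => IsOrientation G o)
    (sourceSinkCount G)

/-- The size of the cut given by the bipartition `(U, Uᶜ)`: the number of edges
with one endpoint in `U` and one endpoint outside `U`. -/
def cutSize {V : Type*} [Fintype V] [DecidableEq V]
    (G : SimpleGraph V) [DecidableRel G.Adj] (U : Finset V) : ℕ :=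
  (G.edgeFinset.filter fun e => ∃ u ∈ U, ∃ v ∈ Uᶜ, e = s(u, v)).card

/-- `maxcut G`: the maximum size of a cut of `G`. -/
def maxcut {V : Type*} [Fintype V] [DecidableEq V]
    (G : SimpleGraph V) [DecidableRel G.Adj] : ℕ :=
  Finset.univ.sup (cutSize G)

/-- A graph is cubic if every vertex has degree 3. -/
def IsCubic {V : Type*} [Fintype V] (G : SimpleGraph V) [DecidableRel G.Adj] : Prop :=
  ∀ v : V, G.degree v = 3

/-- Out-degree minus in-degree. -/
def excess {V : Type*} [Fintype V] (G : SimpleGraph V) [DecidableRel G.Adj]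
    (o : V → V → Bool) (u : V) : ℤ :=
  ∑ v, if G.Adj u v then (if o u v then 1 else -1) else 0

lemma abs_excess {V : Type*} [Fintype V] [DecidableEq V]
    (G : SimpleGraph V) [DecidableRel G.Adj] (hG : IsCubic G) (o : V → V → Bool) (u : V) :
    |excess G o u| = 1 + 2 * ((if ∀ v ∈ G.neighborFinset u, o u v = true then 1 else 0) +
      (if ∀ v ∈ G.neighborFinset u, o u v = false then 1 else 0)) := by
  have h1 : excess G o u = (((G.neighborFinset u).filter fun v => o u v = true).card : ℤ) -
      ((G.neighborFinset u).filter fun v => ¬ o u v = true).card := by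
    rw [Finset.card_filter, Finset.card_filter, excess, ← Finset.sum_filter,
      ← SimpleGraph.neighborFinset_eq_filter]
    push_cast
    rw [← Finset.sum_sub_distrib]
    refine Finset.sum_congr rfl fun v _ => ?_
    cases o u v <;> simp
  have h2 := Finset.card_filter_add_card_filter_not (s := G.neighborFinset u)
    (fun v => o u v = true)
  rw [SimpleGraph.card_neighborFinset_eq_degree, hG u] at h2
  have h3 : (∀ v ∈ G.neighborFinset u, o u v = true) ↔
      ((G.neighborFinset u).filter fun v => ¬ o u v = true).card = 0 := by
    rw [Finset.card_eq_zero, Finset.filter_eq_empty_iff]; simp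
  have h4 : (∀ v ∈ G.neighborFinset u, o u v = false) ↔
      ((G.neighborFinset u).filter fun v => o u v = true).card = 0 := by
    rw [Finset.card_eq_zero, Finset.filter_eq_empty_iff]; simp
  simp only [h1, h3, h4]
  generalize ((G.neighborFinset u).filter fun v => o u v = true).card = a at *
  generalize ((G.neighborFinset u).filter fun v => ¬ o u v = true).card = b at *
  have ha : a ≤ 3 := by omega
  obtain rfl : b = 3 - a := by omega
  interval_cases a <;> simp

lemma sum_abs_excess {V : Type*} [Fintype V] [DecidableEq V]
    (G : SimpleGraph V) [DecidableRel G.Adj] (hG : IsCubic G) (o : V → V → Bool) :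
    ∑ u, |excess G o u| = 2 * (sourceSinkCount G o : ℤ) + Fintype.card V := by
  simp only [abs_excess G hG, sourceSinkCount, Finset.card_filter]
  rw [Finset.sum_add_distrib, ← Finset.mul_sum, Finset.sum_add_distrib]
  push_cast
  simp
  ring

lemma cutSize_eq {V : Type*} [Fintype V] [DecidableEq V]
    (G : SimpleGraph V) [DecidableRel G.Adj] (U : Finset V) :
    (cutSize G U : ℤ) = ∑ u, ∑ v, if G.Adj u v ∧ u ∈ U ∧ v ∉ U then 1 else 0 := by
  have h : cutSize G U = ((Finset.univ : Finset (V × V)).filter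
      fun p => G.Adj p.1 p.2 ∧ p.1 ∈ U ∧ p.2 ∉ U).card := by
    symm
    refine Finset.card_bij (fun p _ => s(p.1, p.2)) ?_ ?_ ?_
    · rintro ⟨u, v⟩ h
      simp only [Finset.mem_filter, Finset.mem_univ, true_and] at h
      simp only [Finset.mem_filter, SimpleGraph.mem_edgeFinset, SimpleGraph.mem_edgeSet]
      exact ⟨h.1, u, h.2.1, v, by simpa using h.2.2, rfl⟩
    · rintro ⟨u, v⟩ h ⟨u', v'⟩ h' e
      simp only [Finset.mem_filter, Finset.mem_univ, true_and] at h h'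
      simp only [Sym2.eq_iff] at e
      rcases e with ⟨rfl, rfl⟩ | ⟨rfl, rfl⟩
      · rfl
      · exact absurd h.2.1 h'.2.2
    · intro e he
      simp only [Finset.mem_filter, SimpleGraph.mem_edgeFinset] at he
      obtain ⟨he, u, hu, v, hv, rfl⟩ := he
      exact ⟨(u, v), by simpa using ⟨he, hu, by simpa using hv⟩, rfl⟩
  rw [h, Finset.card_filter, Fintype.sum_prod_type]
  push_cast
  rfl

/-- Sign of a vertex relative to a cut. -/
def cutSign {V : Type*} [DecidableEq V] (U : Finset V) (u : V) : ℤ := if u ∈ U then 1 else -1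

lemma two_sum_sign {V : Type*} [Fintype V] [DecidableEq V]
    (G : SimpleGraph V) [DecidableRel G.Adj] (o : V → V → Bool) (ho : IsOrientation G o)
    (U : Finset V) :
    2 * ∑ u, cutSign U u * excess G o u = ∑ u, ∑ v, (if G.Adj u v then
      (cutSign U u - cutSign U v) * (if o u v then 1 else -1) else 0) := by
  have h1 : ∑ u, cutSign U u * excess G o u = ∑ u, ∑ v, (if G.Adj u v then
      cutSign U u * (if o u v then 1 else -1) else 0) := by
    simp only [excess, Finset.mul_sum, mul_ite, mul_zero]
  have h2 : ∑ u, cutSign U u * excess G o u = ∑ u, ∑ v, (if G.Adj u v then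
      - cutSign U v * (if o u v then 1 else -1) else 0) := by
    rw [h1, Finset.sum_comm]
    refine Finset.sum_congr rfl fun u _ => Finset.sum_congr rfl fun v _ => ?_
    by_cases h : G.Adj u v
    · rw [if_pos h, if_pos h.symm, ho u v h]
      cases o v u <;> simp
    · rw [if_neg h, if_neg (fun h' => h h'.symm)]
  rw [two_mul]
  nth_rewrite 1 [h1]
  rw [h2, ← Finset.sum_add_distrib]
  refine Finset.sum_congr rfl fun u _ => ?_
  rw [← Finset.sum_add_distrib]
  refine Finset.sum_congr rfl fun v _ => ?_
  split_ifs <;> ring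

lemma four_cut {V : Type*} [Fintype V] [DecidableEq V]
    (G : SimpleGraph V) [DecidableRel G.Adj] (U : Finset V) :
    2 * (2 * (cutSize G U : ℤ)) = ∑ u, ∑ v, (if G.Adj u v then
      |cutSign U u - cutSign U v| else 0) := by
  have h2 : (cutSize G U : ℤ) = ∑ u, ∑ v, if G.Adj u v ∧ v ∈ U ∧ u ∉ U then 1 else 0 := by
    rw [cutSize_eq, Finset.sum_comm]
    simp only [G.adj_comm]
  rw [two_mul (cutSize G U : ℤ)]
  nth_rewrite 1 [cutSize_eq]
  rw [h2, ← Finset.sum_add_distrib, Finset.mul_sum]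
  refine Finset.sum_congr rfl fun u _ => ?_
  rw [← Finset.sum_add_distrib, Finset.mul_sum]
  refine Finset.sum_congr rfl fun v _ => ?_
  by_cases h : G.Adj u v <;> by_cases hu : u ∈ U <;> by_cases hv : v ∈ U <;>
    simp [h, hu, hv, cutSign]

lemma orientation_le {V : Type*} [Fintype V] [DecidableEq V]
    (G : SimpleGraph V) [DecidableRel G.Adj] (hG : IsCubic G) (o : V → V → Bool)
    (ho : IsOrientation G o) :
    ∃ U, 2 * sourceSinkCount G o + Fintype.card V ≤ 2 * cutSize G U := by
  refine ⟨Finset.univ.filter fun u => 0 ≤ excess G o u, ?_⟩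
  set U := Finset.univ.filter fun u => 0 ≤ excess G o u with hU
  zify
  rw [← sum_abs_excess G hG]
  have h : ∑ u, |excess G o u| = ∑ u, cutSign U u * excess G o u := by
    refine Finset.sum_congr rfl fun u _ => ?_
    by_cases h : 0 ≤ excess G o u
    · simp [cutSign, hU, h]
    · simp [cutSign, hU, h, abs_of_neg (not_le.mp h)]
  have h3 : 2 * ∑ u, cutSign U u * excess G o u ≤ 2 * (2 * (cutSize G U : ℤ)) := by
    rw [two_sum_sign G o ho, four_cut]
    refine Finset.sum_le_sum fun u _ => Finset.sum_le_sum fun v _ => ?_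
    split_ifs
    · rw [mul_one]; exact le_abs_self _
    · rw [mul_neg_one]; exact neg_le_abs _
    · exact le_rfl
  linarith

lemma cut_le {V : Type*} [Fintype V] [DecidableEq V]
    (G : SimpleGraph V) [DecidableRel G.Adj] (hG : IsCubic G) (U : Finset V) :
    ∃ o, IsOrientation G o ∧ 2 * cutSize G U ≤ 2 * sourceSinkCount G o + Fintype.card V := by
  let o : V → V → Bool := fun u v =>
    if u ∈ U then (if v ∈ U then decide (Fintype.equivFin V u < Fintype.equivFin V v) else true)
    else (if v ∈ U then false else decide (Fintype.equivFin V u < Fintype.equivFin V v))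
  have ho : IsOrientation G o := by
    intro u v h
    have hne : Fintype.equivFin V u ≠ Fintype.equivFin V v := by simpa using h.ne
    have hd : decide (Fintype.equivFin V u < Fintype.equivFin V v) =
        !decide (Fintype.equivFin V v < Fintype.equivFin V u) := by
      rw [← decide_not, decide_eq_decide, not_lt]
      exact ⟨le_of_lt, fun h => lt_of_le_of_ne h hne⟩
    by_cases hu : u ∈ U <;> by_cases hv : v ∈ U <;> simp only [o, hu, hv, if_true, if_false] <;>
      first | exact hd | rfl
  refine ⟨o, ho, ?_⟩
  zify
  rw [← sum_abs_excess G hG]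
  have h : ∑ u, cutSign U u * excess G o u ≤ ∑ u, |excess G o u| := by
    refine Finset.sum_le_sum fun u _ => ?_
    unfold cutSign
    split_ifs
    · rw [one_mul]; exact le_abs_self _
    · rw [neg_one_mul]; exact neg_le_abs _
  have h3 : 2 * ∑ u, cutSign U u * excess G o u = 2 * (2 * (cutSize G U : ℤ)) := by
    rw [two_sum_sign G o ho, four_cut]
    refine Finset.sum_congr rfl fun u _ => Finset.sum_congr rfl fun v _ => ?_
    by_cases hu : u ∈ U <;> by_cases hv : v ∈ U <;> simp [o, hu, hv, cutSign]
  linarith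

/-- For every finite cubic simple graph `G`, `msso G = maxcut G − |V|/2`,
stated without truncated subtraction as `2 * msso G + |V| = 2 * maxcut G`. -/
theorem msso_eq_maxcut_sub_half_card {V : Type*} [Fintype V] [DecidableEq V]
    (G : SimpleGraph V) [DecidableRel G.Adj] (hG : IsCubic G) :
    2 * msso G + Fintype.card V = 2 * maxcut G := by
  apply le_antisymm
  · obtain ⟨o, ho, he⟩ := Finset.exists_mem_eq_sup
      (Finset.univ.filter fun o : V → V → Bool => IsOrientation G o)
      (by obtain ⟨o, ho, _⟩ := cut_le G hG ∅
          exact ⟨o, by simpa using ho⟩) (sourceSinkCount G)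
    obtain ⟨U, hU⟩ := orientation_le G hG o (by simpa using ho)
    have : cutSize G U ≤ maxcut G := Finset.le_sup (f := cutSize G) (Finset.mem_univ U)
    unfold msso
    omega
  · obtain ⟨U, -, he⟩ := Finset.exists_mem_eq_sup (Finset.univ : Finset (Finset V))
      Finset.univ_nonempty (cutSize G)
    obtain ⟨o, ho, h⟩ := cut_le G hG U
    have : sourceSinkCount G o ≤ msso G :=
      Finset.le_sup (f := sourceSinkCount G) (by simpa using ho)
    unfold maxcut
    omega
end

section
/- For every finite cubic simple graph G = (V,E), msso(G) ≥ maxcut(G) − |V|/2; equivalently, 2·msso(G) + |V| ≥ 2·maxcut(G). -/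
theorem cut_le_aux {V : Type*} [Fintype V] [DecidableEq V]
    (G : SimpleGraph V) [DecidableRel G.Adj] (hG : IsCubic G) (U : Finset V) :
    2 * cutSize G U ≤ 2 * msso G + Fintype.card V := by
  classical
  let f := Fintype.equivFin V
  let o : V → V → Bool := fun u v =>
    if u ∈ U then (if v ∈ U then decide (f u < f v) else true)
    else (if v ∈ U then false else decide (f u < f v))
  have ho : IsOrientation G o := by
    intro u v h
    have hne : f u ≠ f v := fun e => h.ne (f.injective e)
    by_cases hu : u ∈ U <;> by_cases hv : v ∈ U <;> simp [o, hu, hv]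
    all_goals
      rcases lt_or_gt_of_ne hne with h1 | h1
      · simp [h1, h1.le]
      · simp [h1, h1.le]
  have h1 : sourceSinkCount G o ≤ msso G :=
    Finset.le_sup (f := sourceSinkCount G) (by simpa using ho)
  let bad : V → Prop := fun v => ∃ u, G.Adj v u ∧ (v ∈ U ↔ u ∈ U) ∧
    ((v ∈ U ∧ f u ≤ f v) ∨ (v ∉ U ∧ f v < f u))
  have h2 : (Finset.univ.filter fun v => ¬ bad v).card ≤ sourceSinkCount G o := by
    unfold sourceSinkCount
    refine le_trans (Finset.card_le_card ?_) (Finset.card_union_le _ _)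
    intro v hv
    simp only [Finset.mem_filter, Finset.mem_univ, true_and, Finset.mem_union,
      SimpleGraph.mem_neighborFinset] at hv ⊢
    by_cases hvU : v ∈ U
    · left
      intro u hu
      by_contra hc
      apply hv
      by_cases huU : u ∈ U
      · exact ⟨u, hu, by simp [hvU, huU], Or.inl ⟨hvU, by simpa [o, hvU, huU] using hc⟩⟩
      · simp [o, hvU, huU] at hc
    · right
      intro u hu
      by_contra hc
      apply hv
      by_cases huU : u ∈ U
      · simp [o, hvU, huU] at hc
      · exact ⟨u, hu, by simp [hvU, huU], Or.inr ⟨hvU, by simpa [o, hvU, huU] using hc⟩⟩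
  have h3 : (Finset.univ.filter fun v => bad v).card ≤
      (G.edgeFinset.filter fun e => ¬ ∃ u ∈ U, ∃ v ∈ Uᶜ, e = s(u, v)).card := by
    let g : V → V := fun v => if h : bad v then h.choose else v
    have hg : ∀ v, bad v → G.Adj v (g v) ∧ (v ∈ U ↔ g v ∈ U) ∧
        ((v ∈ U ∧ f (g v) ≤ f v) ∨ (v ∉ U ∧ f v < f (g v))) := by
      intro v h
      simp only [g, dif_pos h]
      exact h.choose_spec
    refine Finset.card_le_card_of_injOn (fun v => s(v, g v)) ?_ ?_
    · intro v hv
      have hv' : bad v := by simpa using hv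
      obtain ⟨ha, hb, -⟩ := hg v hv'
      simp only [Finset.coe_filter, Set.mem_setOf_eq, SimpleGraph.mem_edgeFinset,
        SimpleGraph.mem_edgeSet]
      refine ⟨ha, ?_⟩
      rintro ⟨a, haU, b, hbU, hab⟩
      rw [Finset.mem_compl] at hbU
      rcases Sym2.eq_iff.1 hab with ⟨e1, e2⟩ | ⟨e1, e2⟩
      · rw [e2, e1] at hb; tauto
      · rw [e2, e1] at hb; tauto
    · intro v hv w hw hvw
      obtain ⟨ha, hb, hc⟩ := hg v (by simpa using hv)
      obtain ⟨ha', hb', hc'⟩ := hg w (by simpa using hw)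
      rcases Sym2.eq_iff.1 hvw with ⟨e1, e2⟩ | ⟨e1, e2⟩
      · exact e1
      · rw [e2] at hb hc
        rw [← e1] at hc'
        apply f.injective
        rcases hc with ⟨x, y⟩ | ⟨x, y⟩ <;> rcases hc' with ⟨x', y'⟩ | ⟨x', y'⟩
        · exact le_antisymm y' y
        · tauto
        · tauto
        · exact absurd y (lt_asymm y')
  have h4 := Finset.card_filter_add_card_filter_not (s := (Finset.univ : Finset V)) (fun v => bad v)
  have h5 := Finset.card_filter_add_card_filter_not (s := G.edgeFinset)
    (fun e => ∃ u ∈ U, ∃ v ∈ Uᶜ, e = s(u, v))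
  have h6 := G.sum_degrees_eq_twice_card_edges
  rw [Finset.sum_congr rfl (fun v _ => hG v)] at h6
  simp only [Finset.sum_const, smul_eq_mul, Finset.card_univ] at h6 h4
  have h7 : cutSize G U = (G.edgeFinset.filter fun e => ∃ u ∈ U, ∃ v ∈ Uᶜ, e = s(u, v)).card := by
    unfold cutSize
    congr
  omega

/-- For every finite cubic simple graph `G`, `msso G ≥ maxcut G − |V|/2`,
stated without truncated subtraction as `2 * msso G + |V| ≥ 2 * maxcut G`. -/
theorem msso_ge_maxcut_sub_half_card {V : Type*} [Fintype V] [DecidableEq V]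
    (G : SimpleGraph V) [DecidableRel G.Adj] (hG : IsCubic G) :
    2 * maxcut G ≤ 2 * msso G + Fintype.card V := by
  obtain ⟨U, -, hU⟩ := Finset.exists_mem_eq_sup (Finset.univ : Finset (Finset V))
    ⟨∅, Finset.mem_univ _⟩ (cutSize G)
  unfold maxcut
  rw [hU]
  exact cut_le_aux G hG U
end

section
/- For every finite cubic simple graph G = (V,E), msso(G) ≤ maxcut(G) − |V|/2; equivalently, 2·msso(G) + |V| ≤ 2·maxcut(G). -/
theorem cut_ge_aux {V : Type*} [Fintype V] [DecidableEq V]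
    (G : SimpleGraph V) [DecidableRel G.Adj] (U : Finset V) :
    ∑ v ∈ U, ∑ u ∈ Uᶜ, (if G.Adj v u then (1 : ℤ) else 0) ≤ cutSize G U := by
  have h : ((U ×ˢ Uᶜ).filter fun p => G.Adj p.1 p.2).card ≤ cutSize G U := by
    unfold cutSize
    apply Finset.card_le_card_of_injOn (fun p => s(p.1, p.2))
    · rintro ⟨a, b⟩ hp
      simp only [Finset.coe_filter, Finset.mem_product, Set.mem_setOf_eq] at hp
      simp only [Finset.coe_filter, Set.mem_setOf_eq, SimpleGraph.mem_edgeFinset,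
        SimpleGraph.mem_edgeSet]
      exact ⟨hp.2, a, hp.1.1, b, hp.1.2, rfl⟩
    · rintro ⟨a, b⟩ hp ⟨c, d⟩ hq h
      simp only [Finset.coe_filter, Finset.mem_product, Set.mem_setOf_eq,
        Finset.mem_compl] at hp hq
      simp only [Sym2.eq_iff] at h
      rcases h with ⟨rfl, rfl⟩ | ⟨rfl, rfl⟩
      · rfl
      · exact absurd hp.1.1 hq.1.2
  rw [← Finset.sum_product', Finset.sum_boole]
  exact_mod_cast h

theorem antisymm_sum_aux {V : Type*} (s : V → V → ℤ) (hs : ∀ u v, s u v = - s v u)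
    (A : Finset V) : ∑ v ∈ A, ∑ u ∈ A, s v u = 0 := by
  have h : ∑ v ∈ A, ∑ u ∈ A, s v u = - ∑ v ∈ A, ∑ u ∈ A, s v u := by
    conv_lhs => rw [Finset.sum_comm]
    simp only [← Finset.sum_neg_distrib]
    exact Finset.sum_congr rfl fun v _ => Finset.sum_congr rfl fun u _ => hs u v
  omega

theorem orientation_aux {V : Type*} [Fintype V] [DecidableEq V]
    (G : SimpleGraph V) [DecidableRel G.Adj] (hG : IsCubic G) (o : V → V → Bool)
    (ho : IsOrientation G o) :
    2 * sourceSinkCount G o + Fintype.card V ≤ 2 * maxcut G := by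
  classical
  set s : V → V → ℤ := fun v u => if G.Adj v u then (if o v u = true then 1 else -1) else 0
    with hsdef
  have hs : ∀ u v, s u v = - s v u := by
    intro u v
    simp only [hsdef]
    by_cases h : G.Adj u v
    · have := ho u v h
      have h' := h.symm
      cases h1 : o u v <;> cases h2 : o v u <;> simp_all
    · have h' : ¬ G.Adj v u := fun h' => h h'.symm
      simp [h, h']
  set d : V → ℤ := fun v => ∑ u, s v u with hd
  set U : Finset V := Finset.univ.filter fun v => 0 < d v with hU
  have hsplit : ∑ v ∈ U, d v = ∑ v ∈ U, ∑ u ∈ Uᶜ, s v u := by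
    have h0 := antisymm_sum_aux s hs U
    have : ∑ v ∈ U, d v = ∑ v ∈ U, ∑ u ∈ U, s v u + ∑ v ∈ U, ∑ u ∈ Uᶜ, s v u := by
      rw [← Finset.sum_add_distrib]
      exact Finset.sum_congr rfl fun v _ => (Finset.sum_add_sum_compl U _).symm
    rw [this, h0, zero_add]
  have hle : ∑ v ∈ U, d v ≤ cutSize G U := by
    rw [hsplit]
    refine le_trans ?_ (cut_ge_aux G U)
    refine Finset.sum_le_sum fun v _ => Finset.sum_le_sum fun u _ => ?_
    simp only [hsdef]
    split_ifs <;> norm_num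
  have hmax : cutSize G U ≤ maxcut G := Finset.le_sup (f := cutSize G) (Finset.mem_univ U)
  have htot : ∑ v ∈ U, d v + ∑ v ∈ Uᶜ, d v = 0 := by
    rw [Finset.sum_add_sum_compl]
    exact antisymm_sum_aux s hs Finset.univ
  have habs : ∑ v, |d v| = ∑ v ∈ U, d v - ∑ v ∈ Uᶜ, d v := by
    rw [← Finset.sum_add_sum_compl U, sub_eq_add_neg, ← Finset.sum_neg_distrib]
    congr 1
    · refine Finset.sum_congr rfl fun v hv => abs_of_pos ?_
      simpa [hU] using hv
    · refine Finset.sum_congr rfl fun v hv => abs_of_nonpos ?_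
      simpa [hU] using hv
  have hpt : ∀ v, 2 * ((if ∀ u ∈ G.neighborFinset v, o v u = true then (1 : ℤ) else 0) +
      (if ∀ u ∈ G.neighborFinset v, o v u = false then (1 : ℤ) else 0)) + 1 ≤ |d v| := by
    intro v
    have hdv : d v = ∑ u ∈ G.neighborFinset v, (if o v u = true then (1 : ℤ) else -1) := by
      simp only [hd, hsdef]
      rw [← Finset.sum_filter]
      congr 1
      ext u
      simp
    have hc : (G.neighborFinset v).card = 3 := by
      rw [SimpleGraph.card_neighborFinset_eq_degree]; exact hG v
    obtain ⟨a, b, c, hab, hac, hbc, hN⟩ := Finset.card_eq_three.mp hc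
    rw [hdv, hN]
    rw [Finset.sum_insert (by simp [hab, hac]), Finset.sum_insert (by simp [hbc]),
      Finset.sum_singleton]
    cases h1 : o v a <;> cases h2 : o v b <;> cases h3 : o v c <;> simp [h1, h2, h3]
  have hsum := Finset.sum_le_sum (s := Finset.univ) fun v _ => hpt v
  rw [habs, Finset.sum_add_distrib, ← Finset.mul_sum, Finset.sum_add_distrib,
    Finset.sum_boole, Finset.sum_boole] at hsum
  simp only [Finset.sum_const, Finset.card_univ, nsmul_eq_mul, mul_one] at hsum
  unfold sourceSinkCount
  zify at hmax ⊢
  linarith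

/-- For every finite cubic simple graph `G`, `msso G ≤ maxcut G − |V|/2`,
stated without truncated subtraction as `2 * msso G + |V| ≤ 2 * maxcut G`. -/
theorem msso_le_maxcut_sub_half_card {V : Type*} [Fintype V] [DecidableEq V]
    (G : SimpleGraph V) [DecidableRel G.Adj] (hG : IsCubic G) :
    2 * msso G + Fintype.card V ≤ 2 * maxcut G := by
  have hne : (Finset.univ.filter fun o : V → V → Bool => IsOrientation G o).Nonempty := by
    obtain ⟨f⟩ : Nonempty (V ≃ Fin (Fintype.card V)) := ⟨Fintype.equivFin V⟩
    refine ⟨fun u v => decide (f u < f v), Finset.mem_filter.mpr ⟨Finset.mem_univ _, ?_⟩⟩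
    intro u v huv
    have hne : f u ≠ f v := fun h => huv.ne (f.injective h)
    rcases lt_or_gt_of_ne hne with h | h
    · simp [h, h.le]
    · simp [h, h.le]
  obtain ⟨o, ho, heq⟩ := Finset.exists_mem_eq_sup _ hne (sourceSinkCount G)
  unfold msso
  rw [heq]
  exact orientation_aux G hG o (Finset.mem_filter.mp ho).2
end

section
/- For every finite cubic simple graph G = (V,E), msso(G) ≥ |V|/2; equivalently, 2·msso(G) ≥ |V|. -/
/-- A colouring such that every vertex has at most one neighbour of its own colour. -/
lemma exists_good_colouring {V : Type*} [Fintype V] [DecidableEq V]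
    (G : SimpleGraph V) [DecidableRel G.Adj] (hG : IsCubic G) :
    ∃ f : V → Bool, ∀ x u v, G.Adj x u → G.Adj x v → f u = f x → f v = f x → u = v := by
  classical
  let sg : Bool → ℤ := fun b => if b then 1 else -1
  let a : V → V → ℤ := fun u v => if G.Adj u v then 1 else 0
  have asym : ∀ u v, a u v = a v u := by
    intro u v
    simp only [a, G.adj_comm]
  have adiag : ∀ u, a u u = 0 := by
    intro u
    simp [a]
  let H : (V → ℤ) → ℤ := fun s => ∑ v, ∑ u, a v u * s v * s u
  obtain ⟨f, hf⟩ := Finite.exists_min (fun f : V → Bool => H (fun v => sg (f v)))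
  have expand : ∀ (s : V → ℤ) (x : V) (c : ℤ),
      H (fun v => s v + if v = x then c else 0) = H s + 2 * c * ∑ u, a x u * s u := by
    intro s x c
    have h1 : ∀ v u, a v u * (s v + if v = x then c else 0) * (s u + if u = x then c else 0)
        = a v u * s v * s u + (if v = x then c * (a v u * s u) else 0)
          + (if u = x then c * (a v u * s v) else 0)
          + (if u = x then (if v = x then a v u * c * c else 0) else 0) := by
      intro v u
      split_ifs <;> ring
    simp only [H, h1, Finset.sum_add_distrib]
    have h2 : ∑ v, ∑ u, (if v = x then c * (a v u * s u) else 0) = c * ∑ u, a x u * s u := by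
      rw [Finset.sum_comm]
      simp [Finset.mul_sum]
    have h3 : ∑ v, ∑ u, (if u = x then c * (a v u * s v) else 0) = c * ∑ u, a x u * s u := by
      simp [Finset.mul_sum, asym x]
    have h4 : ∑ v, ∑ u, (if u = x then (if v = x then a v u * c * c else 0) else 0) = 0 := by
      simp [adiag]
    rw [h2, h3, h4]
    ring
  refine ⟨f, ?_⟩
  intro x u v hu hv hfu hfv
  by_contra huv
  have key := hf (Function.update f x (!f x))
  have hupd : (fun v => sg (Function.update f x (!f x) v))
      = fun v => sg (f v) + if v = x then -2 * sg (f x) else 0 := by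
    funext w
    by_cases hw : w = x
    · subst hw
      simp only [Function.update_self, if_true, sg]
      cases f w <;> simp
    · simp [hw]
  simp only [hupd, expand] at key
  -- the sum over the neighbourhood
  have hsum : ∑ w, a x w * sg (f w) = ∑ w ∈ G.neighborFinset x, sg (f w) := by
    simp only [a, ite_mul, one_mul, zero_mul]
    rw [← Finset.sum_filter]
    congr 1
    ext w
    simp
  rw [hsum] at key
  have hcard : (G.neighborFinset x).card = 3 := by
    rw [G.card_neighborFinset_eq_degree]
    exact hG x
  have hu' : u ∈ G.neighborFinset x := by simpa using hu
  have hv' : v ∈ (G.neighborFinset x).erase u := by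
    simp [hv, Ne.symm huv]
  rw [← Finset.add_sum_erase _ _ hu', ← Finset.add_sum_erase _ _ hv'] at key
  have hc1 : (((G.neighborFinset x).erase u).erase v).card = 1 := by
    rw [Finset.card_erase_of_mem hv', Finset.card_erase_of_mem hu', hcard]
  obtain ⟨w, hw⟩ := Finset.card_eq_one.mp hc1
  rw [hw, Finset.sum_singleton, hfu, hfv] at key
  simp only [sg] at key
  cases h1 : f x <;> cases h2 : f w <;> simp [h1, h2] at key

/-- For every finite cubic simple graph `G`, `msso G ≥ |V|/2`,
stated as `2 * msso G ≥ |V|`. -/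
theorem msso_ge_half_card {V : Type*} [Fintype V] [DecidableEq V]
    (G : SimpleGraph V) [DecidableRel G.Adj] (hG : IsCubic G) :
    Fintype.card V ≤ 2 * msso G := by
  classical
  obtain ⟨f, hf⟩ := exists_good_colouring G hG
  let I : Finset V → Prop := fun S => ∀ u ∈ S, ∀ v ∈ S, G.Adj u v → f u ≠ f v
  obtain ⟨S, hS, hmax⟩ := Finset.exists_max_image (Finset.univ.filter I) Finset.card
    ⟨∅, by simp [I]⟩
  have hI : I S := by simpa using hS
  have hnb : ∀ v, v ∉ S → ∃ u ∈ S, G.Adj v u ∧ f u = f v := by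
    intro v hv
    by_contra! hcon
    have hins : I (insert v S) := by
      intro p hp q hq hpq
      rcases Finset.mem_insert.mp hp with rfl | hp1
      · rcases Finset.mem_insert.mp hq with rfl | hq
        · exact absurd hpq (G.loopless.irrefl _)
        · exact (hcon q hq hpq).symm
      · rcases Finset.mem_insert.mp hq with rfl | hq
        · exact hcon p hp1 hpq.symm
        · exact hI p hp1 q hq hpq
    have := hmax (insert v S) (by simpa using hins)
    rw [Finset.card_insert_of_notMem hv] at this
    omega
  choose! g hgS hgadj hgf using hnb
  have hle : Sᶜ.card ≤ S.card := by
    apply Finset.card_le_card_of_injOn g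
    · intro v hv
      exact hgS v (by simpa using hv)
    · intro p hp q hq hpq
      have hp' : p ∉ S := by simpa using hp
      have hq' : q ∉ S := by simpa using hq
      refine hf (g p) p q (hgadj p hp').symm ?_ (hgf p hp').symm ?_
      · rw [hpq]
        exact (hgadj q hq').symm
      · rw [hpq]
        exact (hgf q hq').symm
  have hcard : Fintype.card V ≤ 2 * S.card := by
    have := Finset.card_add_card_compl S
    omega
  let e := Fintype.equivFin V
  let o : V → V → Bool := fun u v =>
    if u ∈ S then f u else if v ∈ S then !f v else decide (e u < e v)
  have ho : IsOrientation G o := by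
    intro u v huv
    by_cases hu : u ∈ S <;> by_cases hv : v ∈ S
    · have := hI u hu v hv huv
      simp only [o, hu, hv, if_true]
      cases h1 : f u <;> cases h2 : f v <;> simp_all
    · simp [o, hu, hv]
    · simp [o, hu, hv]
    · have hne : e u ≠ e v := fun h => huv.ne (e.injective h)
      simp only [o, hu, hv, if_false]
      rcases lt_or_gt_of_ne hne with h | h
      · simp [h, h.le]
      · simp [h, h.le]
  have hcount : S.card ≤ sourceSinkCount G o := by
    rw [← Finset.card_filter_add_card_filter_not (s := S) (fun v => f v = true)]
    unfold sourceSinkCount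
    apply Nat.add_le_add <;> apply Finset.card_le_card <;> intro v hv <;>
      simp only [Finset.mem_filter] at hv <;> simp [o, hv.1, hv.2]
  have hms : sourceSinkCount G o ≤ msso G :=
    Finset.le_sup (f := sourceSinkCount G) (by simpa using ho)
  omega
end

section
/- Let G = (V,E) be a finite cubic simple graph and let (U,W) be a bipartition of V in which every vertex has at most one neighbour on its own side of the bipartition. Let C be the set of cut edges (edges with one endpoint in U and one in W). Then the edges not in C form a matching (no two of them share an endpoint), and G admits an orientation with at least (|E| − |C|) + (|V| − 2(|E| − |C|)) = |V| − (|E| − |C|) sources plus sinks. -/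
/-- Let `G` be a finite cubic simple graph and `(U, Uᶜ)` a bipartition of its vertices
in which every vertex has at most one neighbour on its own side. Let `C` be the set of
cut edges. Then the edges not in `C` form a matching, and `G` admits an orientation
with at least `(|E| − |C|) + (|V| − 2(|E| − |C|)) = |V| − (|E| − |C|)` sources plus sinks. -/
theorem matching_and_orientation_from_local_cut {V : Type*} [Fintype V] [DecidableEq V]
    (G : SimpleGraph V) [DecidableRel G.Adj] (hG : IsCubic G) (U : Finset V)
    (hU : ∀ v : V, ((G.neighborFinset v).filter fun u => (u ∈ U ↔ v ∈ U)).card ≤ 1) :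
    (∀ e₁ ∈ G.edgeFinset \ (G.edgeFinset.filter fun e => ∃ u ∈ U, ∃ v ∈ Uᶜ, e = s(u, v)),
      ∀ e₂ ∈ G.edgeFinset \ (G.edgeFinset.filter fun e => ∃ u ∈ U, ∃ v ∈ Uᶜ, e = s(u, v)),
        e₁ ≠ e₂ → ∀ v : V, v ∈ e₁ → v ∉ e₂) ∧
    (∃ o : V → V → Bool, IsOrientation G o ∧
      Fintype.card V ≤ sourceSinkCount G o + (G.edgeFinset.card - cutSize G U)) := by
  classical
  have hcut : ∀ a b : V, (∃ u ∈ U, ∃ v ∈ Uᶜ, s(a, b) = s(u, v)) ↔ ¬ (b ∈ U ↔ a ∈ U) := by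
    intro a b
    constructor
    · rintro ⟨u, hu, v, hv, h⟩
      rw [Finset.mem_compl] at hv
      rcases Sym2.eq_iff.mp h with ⟨rfl, rfl⟩ | ⟨rfl, rfl⟩ <;> tauto
    · intro h
      by_cases ha : a ∈ U
      · exact ⟨a, ha, b, by rw [Finset.mem_compl]; tauto, rfl⟩
      · exact ⟨b, by tauto, a, by rw [Finset.mem_compl]; exact ha, Sym2.eq_swap⟩
  have hmem : ∀ a b : V,
      s(a, b) ∈ G.edgeFinset \ (G.edgeFinset.filter fun e => ∃ u ∈ U, ∃ v ∈ Uᶜ, e = s(u, v)) ↔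
        G.Adj a b ∧ (b ∈ U ↔ a ∈ U) := by
    intro a b
    rw [Finset.mem_sdiff, Finset.mem_filter, hcut, SimpleGraph.mem_edgeFinset,
      SimpleGraph.mem_edgeSet]
    tauto
  refine ⟨?_, ?_⟩
  · intro e₁ h₁ e₂ h₂ hne v hv₁ hv₂
    obtain ⟨a, rfl⟩ := Sym2.mem_iff_exists.mp hv₁
    obtain ⟨b, rfl⟩ := Sym2.mem_iff_exists.mp hv₂
    rw [hmem] at h₁ h₂
    apply hne
    have hab : a = b := Finset.card_le_one.mp (hU v) a
      (by simpa using h₁) b (by simpa using h₂)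
    rw [hab]
  · let f := Fintype.equivFin V
    let o : V → V → Bool := fun u v =>
      if (v ∈ U ↔ u ∈ U) then decide (f u < f v) else decide (u ∈ U)
    refine ⟨o, ?_, ?_⟩
    · intro u v huv
      have hne : f u ≠ f v := fun h => huv.ne (f.injective h)
      by_cases h : (v ∈ U ↔ u ∈ U)
      · have h' : (u ∈ U ↔ v ∈ U) := h.symm
        simp only [o, if_pos h, if_pos h']
        rcases lt_or_gt_of_ne hne with hl | hl
        · simp [hl, hl.le]
        · simp [hl, hl.le]
      · have h' : ¬ (u ∈ U ↔ v ∈ U) := fun k => h k.symm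
        simp only [o, if_neg h, if_neg h']
        by_cases hu : u ∈ U <;> by_cases hv : v ∈ U <;> simp_all
    · let S := Finset.univ.filter fun v => ∀ u ∈ G.neighborFinset v, o v u = true
      let T := Finset.univ.filter fun v => ∀ u ∈ G.neighborFinset v, o v u = false
      let B := Finset.univ.filter fun v =>
        ∃ u, G.Adj v u ∧ (u ∈ U ↔ v ∈ U) ∧ o v u = decide (v ∉ U)
      have hcover : (Finset.univ : Finset V) ⊆ (S ∪ T) ∪ B := by
        intro v _
        by_cases hB : v ∈ B
        · exact Finset.mem_union_right _ hB
        · apply Finset.mem_union_left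
          have key : ∀ u ∈ G.neighborFinset v, o v u = decide (v ∈ U) := by
            intro u hu
            rw [SimpleGraph.mem_neighborFinset] at hu
            by_cases h : (u ∈ U ↔ v ∈ U)
            · by_contra hc
              apply hB
              refine Finset.mem_filter.mpr ⟨Finset.mem_univ _, u, hu, h, ?_⟩
              by_cases hv : v ∈ U <;> simpa [hv] using hc
            · simp only [o, if_neg h]
          by_cases hv : v ∈ U
          · apply Finset.mem_union_left
            refine Finset.mem_filter.mpr ⟨Finset.mem_univ _, fun u hu => ?_⟩
            rw [key u hu]; simpa using hv
          · apply Finset.mem_union_right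
            refine Finset.mem_filter.mpr ⟨Finset.mem_univ _, fun u hu => ?_⟩
            rw [key u hu]; simpa using hv
      have hB : B.card ≤ G.edgeFinset.card - cutSize G U := by
        have hx : ∀ v, ∃ u, v ∈ B → G.Adj v u ∧ (u ∈ U ↔ v ∈ U) ∧ o v u = decide (v ∉ U) := by
          intro v
          by_cases hv : v ∈ B
          · obtain ⟨u, hu⟩ := (Finset.mem_filter.mp hv).2
            exact ⟨u, fun _ => hu⟩
          · exact ⟨v, fun h => absurd h hv⟩
        choose g hg using hx
        rw [cutSize, ← Finset.card_sdiff_of_subset (Finset.filter_subset _ _)]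
        apply Finset.card_le_card_of_injOn (fun v => s(v, g v))
        · intro v hv
          have h := hg v hv
          exact (hmem v (g v)).mpr ⟨h.1, h.2.1⟩
        · intro v hv w hw hvw
          rcases Sym2.eq_iff.mp hvw with ⟨h, _⟩ | ⟨h1, h2⟩
          · exact h
          · exfalso
            obtain ⟨a1, a2, a3⟩ := hg v hv
            obtain ⟨b1, b2, b3⟩ := hg w hw
            rw [h2] at a1 a2 a3
            rw [← h1] at b1 b2 b3
            have hne : f v ≠ f w := fun h => a1.ne (f.injective h)
            simp only [o, if_pos a2, if_pos b2, decide_eq_decide] at a3 b3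
            rcases lt_or_gt_of_ne hne with hl | hl
            · have := a3.mp hl
              have : ¬ f w < f v := not_lt.mpr hl.le
              tauto
            · have := b3.mp hl
              have : ¬ f v < f w := not_lt.mpr hl.le
              tauto
      have h1 := Finset.card_le_card hcover
      have h2 := Finset.card_union_le (S ∪ T) B
      have h3 := Finset.card_union_le S T
      rw [Finset.card_univ] at h1
      have h4 : sourceSinkCount G o = S.card + T.card := by
        simp only [sourceSinkCount, S, T]
      omega
end

section
/- Let G = (V,E) be a finite cubic simple graph and consider any orientation of G with s sources and sinks in total. Then G has a cut of size at least s + |V|/2; equivalently, there is a bipartition of V such that twice the number of cut edges is at least 2s + |V|. -/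
lemma two_mul_cutSize_aux {V : Type*} [Fintype V] [DecidableEq V]
    (G : SimpleGraph V) [DecidableRel G.Adj] (U : Finset V) :
    2 * cutSize G U = ∑ v, ((G.neighborFinset v).filter fun w => ¬ (v ∈ U ↔ w ∈ U)).card := by
  classical
  let H : SimpleGraph V :=
    { Adj := fun a b => G.Adj a b ∧ ¬ (a ∈ U ↔ b ∈ U)
      symm := ⟨fun a b h => ⟨h.1.symm, fun h' => h.2 h'.symm⟩⟩
      loopless := ⟨fun a h => h.2 Iff.rfl⟩ }
  have h1 : cutSize G U = H.edgeFinset.card := by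
    unfold cutSize
    congr 1
    ext e
    induction e using Sym2.ind with
    | _ a b =>
      simp only [Finset.mem_filter, SimpleGraph.mem_edgeFinset, SimpleGraph.mem_edgeSet, H,
        Finset.mem_compl]
      refine and_congr_right fun _ => ?_
      constructor
      · rintro ⟨u, hu, v, hv, h⟩
        rcases Sym2.eq_iff.1 h with ⟨rfl, rfl⟩ | ⟨rfl, rfl⟩ <;> tauto
      · intro h
        by_cases ha : a ∈ U
        · exact ⟨a, ha, b, by tauto, rfl⟩
        · exact ⟨b, by tauto, a, ha, Sym2.eq_swap⟩
  rw [h1, ← H.sum_degrees_eq_twice_card_edges]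
  refine Finset.sum_congr rfl fun v _ => ?_
  rw [← SimpleGraph.card_neighborFinset_eq_degree]
  congr 1
  ext w
  simp [H]

lemma exists_local_opt_aux {V : Type*} [Fintype V] [DecidableEq V]
    (G : SimpleGraph V) [DecidableRel G.Adj] (hG : IsCubic G)
    (S T : Finset V) (hST : Disjoint S T) :
    ∃ U : Finset V, S ⊆ U ∧ Disjoint U T ∧ ∀ v, v ∉ S ∪ T →
      ((G.neighborFinset v).filter fun w => (v ∈ U ↔ w ∈ U)).card ≤ 1 := by
  classical
  let x : Finset V → V → ℤ := fun U v => if v ∈ U then 1 else -1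
  let A := G.adjMatrix ℤ
  let Q : Finset V → ℤ := fun U => x U ⬝ᵥ (A.mulVec (x U))
  obtain ⟨U, hU, hmin⟩ := Finset.exists_min_image
    (Finset.univ.filter fun U : Finset V => S ⊆ U ∧ Disjoint U T) Q
    ⟨S, by simp [hST]⟩
  simp only [Finset.mem_filter, Finset.mem_univ, true_and] at hU hmin
  refine ⟨U, hU.1, hU.2, fun v hv => ?_⟩
  simp only [Finset.mem_union, not_or] at hv
  -- flip `v`
  let U' : Finset V := if v ∈ U then U.erase v else insert v U
  have hU' : S ⊆ U' ∧ Disjoint U' T := by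
    by_cases h : v ∈ U
    · simp only [U', h, if_true]
      exact ⟨Finset.subset_erase.2 ⟨hU.1, hv.1⟩, hU.2.mono_left (Finset.erase_subset _ _)⟩
    · simp only [U', h, if_false]
      exact ⟨hU.1.trans (Finset.subset_insert _ _), Finset.disjoint_insert_left.2 ⟨hv.2, hU.2⟩⟩
  have hx : x U' = x U + Pi.single v (-2 * x U v) := by
    ext w
    by_cases hw : w = v
    · subst hw
      by_cases h : w ∈ U <;> simp [x, U', h]
    · by_cases h : v ∈ U <;> simp [x, U', h, hw]
  have hQ : Q U' = Q U - 4 * (x U v * (A.mulVec (x U)) v) := by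
    simp only [Q, hx, Matrix.mulVec_add, add_dotProduct, dotProduct_add, single_dotProduct]
    have e1 : x U ⬝ᵥ A.mulVec (Pi.single v (-2 * x U v)) = -2 * x U v * (A.mulVec (x U)) v := by
      rw [Matrix.dotProduct_mulVec, ← Matrix.mulVec_transpose, dotProduct_single,
        SimpleGraph.transpose_adjMatrix]
      ring
    have e2 : (A.mulVec (Pi.single v (-2 * x U v))) v = 0 := by
      simp [A]
    rw [e1, e2]
    ring
  have h0 : x U v * (A.mulVec (x U)) v ≤ 0 := by
    have := hmin U' hU'
    linarith
  rw [SimpleGraph.adjMatrix_mulVec_apply, Finset.mul_sum] at h0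
  have h1 : ∀ w ∈ G.neighborFinset v, x U v * x U w =
      2 * (if (v ∈ U ↔ w ∈ U) then 1 else 0) - 1 := by
    intro w _
    by_cases h : v ∈ U <;> by_cases h' : w ∈ U <;> simp [x, h, h']
  rw [Finset.sum_congr rfl h1, Finset.sum_sub_distrib, ← Finset.mul_sum, Finset.sum_boole] at h0
  have h3 : (G.neighborFinset v).card = 3 := by
    rw [SimpleGraph.card_neighborFinset_eq_degree]; exact hG v
  simp only [Finset.sum_const, h3] at h0
  norm_num at h0
  omega

/-- Let `G` be a finite cubic simple graph and consider any orientation of `G` with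
`s` sources plus sinks in total. Then `G` has a cut of size at least `s + |V|/2`,
stated as: there is a bipartition with `2 * (cut size) ≥ 2s + |V|`. -/
theorem cut_from_orientation {V : Type*} [Fintype V] [DecidableEq V]
    (G : SimpleGraph V) [DecidableRel G.Adj] (hG : IsCubic G)
    (o : V → V → Bool) (ho : IsOrientation G o) :
    ∃ U : Finset V, 2 * sourceSinkCount G o + Fintype.card V ≤ 2 * cutSize G U := by
  classical
  set S := Finset.univ.filter fun v => ∀ u ∈ G.neighborFinset v, o v u = true with hS
  set T := Finset.univ.filter fun v => ∀ u ∈ G.neighborFinset v, o v u = false with hT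
  have hs : sourceSinkCount G o = S.card + T.card := rfl
  have h3 : ∀ v, (G.neighborFinset v).card = 3 := fun v => by
    rw [SimpleGraph.card_neighborFinset_eq_degree]; exact hG v
  have hST : Disjoint S T := by
    rw [Finset.disjoint_left]
    intro v h1 h2
    obtain ⟨u, hu⟩ : (G.neighborFinset v).Nonempty := by
      rw [← Finset.card_pos, h3]; norm_num
    have a := (Finset.mem_filter.1 h1).2 u hu
    have b := (Finset.mem_filter.1 h2).2 u hu
    simp [a] at b
  have hSS : ∀ v ∈ S, ∀ w ∈ S, ¬ G.Adj v w := by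
    intro v hv w hw h
    have a := (Finset.mem_filter.1 hv).2 w (by simpa using h)
    have b := (Finset.mem_filter.1 hw).2 v (by simpa using h.symm)
    have c := ho v w h
    simp [a, b] at c
  have hTT : ∀ v ∈ T, ∀ w ∈ T, ¬ G.Adj v w := by
    intro v hv w hw h
    have a := (Finset.mem_filter.1 hv).2 w (by simpa using h)
    have b := (Finset.mem_filter.1 hw).2 v (by simpa using h.symm)
    have c := ho v w h
    simp [a, b] at c
  obtain ⟨U, hSU, hUT, hloc⟩ := exists_local_opt_aux G hG S T hST
  refine ⟨U, ?_⟩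
  rw [two_mul_cutSize_aux, hs, ← Finset.card_union_of_disjoint hST]
  set P := S ∪ T with hP
  let c : V → ℕ := fun v => ((G.neighborFinset v).filter fun w => ¬ (v ∈ U ↔ w ∈ U)).card
  let n : V → ℕ := fun v => ((G.neighborFinset v).filter fun w => (v ∈ U ↔ w ∈ U)).card
  have hcn : ∀ v, n v + c v = 3 := fun v => by
    rw [← h3 v]; exact Finset.card_filter_add_card_filter_not _
  let r : V → V → Prop := fun v w => G.Adj v w ∧ (v ∈ U ↔ w ∈ U)
  have hPn : ∑ v ∈ P, n v ≤ ∑ w ∈ Pᶜ, n w := by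
    have e1 : ∑ v ∈ P, n v = ∑ v ∈ P, (Finset.bipartiteAbove r Pᶜ v).card := by
      refine Finset.sum_congr rfl fun v hv => ?_
      simp only [n]
      congr 1
      ext w
      simp only [Finset.mem_filter, SimpleGraph.mem_neighborFinset, Finset.mem_bipartiteAbove,
        Finset.mem_compl, r]
      refine ⟨fun h => ⟨fun hw => ?_, h⟩, fun h => h.2⟩
      have hd := Finset.disjoint_right.1 hUT
      rcases Finset.mem_union.1 hv with hv | hv <;> rcases Finset.mem_union.1 hw with hw | hw
      · exact hSS v hv w hw h.1
      · exact hd hw (h.2.1 (hSU hv))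
      · exact hd hv (h.2.2 (hSU hw))
      · exact hTT v hv w hw h.1
    rw [e1, Finset.sum_card_bipartiteAbove_eq_sum_card_bipartiteBelow]
    refine Finset.sum_le_sum fun w _ => Finset.card_le_card fun v hv => ?_
    simp only [Finset.mem_bipartiteBelow, r] at hv
    simp only [Finset.mem_filter, SimpleGraph.mem_neighborFinset]
    exact ⟨hv.2.1.symm, hv.2.2.symm⟩
  have hRn : ∑ w ∈ Pᶜ, n w ≤ Pᶜ.card := by
    rw [Finset.card_eq_sum_ones]
    exact Finset.sum_le_sum fun w hw => hloc w (Finset.mem_compl.1 hw)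
  have htot : ∑ v, n v + ∑ v, c v = 3 * Fintype.card V := by
    rw [← Finset.sum_add_distrib, Finset.sum_congr rfl fun v _ => hcn v]
    simp [mul_comm]
  have hsplit : ∑ v ∈ P, n v + ∑ v ∈ Pᶜ, n v = ∑ v, n v := Finset.sum_add_sum_compl _ _
  have hcard : P.card + Pᶜ.card = Fintype.card V := Finset.card_add_card_compl P
  change 2 * P.card + Fintype.card V ≤ ∑ v, c v
  omega
end

section
/- Let E be a finite set, S a nonempty finite set, m a positive integer, h : S × E → ℕ with h(s,e) ≤ m for all s and e, and p : E → ℝ with p(e) > 0 for all e. Define f(c) = ∑_{s∈S} 2^{−m} ∏_{e∈E} (c·p(e))^{h(s,e)} · (1 − c·p(e))^{m − h(s,e)}, and let L = min_{s∈S} ∑_{e∈E} h(s,e). Then f(c) = Θ(c^L) as c → 0 from the right, i.e. f is bounded above and below by positive constant multiples of c^L on some right neighbourhood of 0. -/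
/-- Likelihood of a scaled tree under the Cavender–Farris model: `E` indexes the
edges, `S` the extensions of an alignment of `m` binary characters, `h s e` the
Hamming distance across edge `e` under extension `s`, and `p e` the edge
probability before rescaling by `c`. Then
`f c = ∑ s, 2^{-m} ∏ e, (c*p e)^{h s e} (1 - c*p e)^{m - h s e}`
is `Θ(c^L)` as `c → 0⁺`, where `L = min_s ∑ e, h s e` is the parsimony score:
`f` is bounded above and below by positive constant multiples of `c^L` on some
right neighbourhood of `0`. -/
theorem likelihood_isTheta_parsimony {E S : Type*} [Fintype E] [Fintype S] [Nonempty S]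
    (m : ℕ) (hm : 0 < m) (h : S → E → ℕ) (hh : ∀ s e, h s e ≤ m)
    (p : E → ℝ) (hp : ∀ e, 0 < p e) :
    ∃ ε > (0:ℝ), ∃ k₁ > (0:ℝ), ∃ k₂ > (0:ℝ), ∀ c : ℝ, 0 < c → c < ε →
      k₁ * c ^ (Finset.univ.inf' Finset.univ_nonempty fun s => ∑ e, h s e) ≤
        (∑ s : S, (1/2 : ℝ) ^ m *
          ∏ e, (c * p e) ^ h s e * (1 - c * p e) ^ (m - h s e)) ∧
      (∑ s : S, (1/2 : ℝ) ^ m *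
          ∏ e, (c * p e) ^ h s e * (1 - c * p e) ^ (m - h s e)) ≤
        k₂ * c ^ (Finset.univ.inf' Finset.univ_nonempty fun s => ∑ e, h s e) := by
  classical
  have hP : 0 ≤ ∑ e, p e := Finset.sum_nonneg fun e _ => (hp e).le
  obtain ⟨s₀, -, hs₀⟩ := Finset.exists_mem_eq_inf' (Finset.univ_nonempty (α := S))
    (fun s => ∑ e, h s e)
  have hle : ∀ s, (Finset.univ.inf' Finset.univ_nonempty fun s => ∑ e, h s e) ≤ ∑ e, h s e :=
    fun s => Finset.inf'_le (fun s => ∑ e, h s e) (Finset.mem_univ s)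
  have hk : ∀ s, 0 < ∏ e, p e ^ h s e := fun s =>
    Finset.prod_pos fun e _ => pow_pos (hp e) _
  refine ⟨1 / (2 * (1 + ∑ e, p e)), by positivity,
    (1/2 : ℝ) ^ m * ∏ e, p e ^ h s₀ e * (1/2 : ℝ) ^ (m - h s₀ e),
    mul_pos (by positivity) (Finset.prod_pos fun e _ => mul_pos (pow_pos (hp e) _) (by positivity)),
    ∑ s, (1/2 : ℝ) ^ m * ∏ e, p e ^ h s e,
    Finset.sum_pos (fun s _ => mul_pos (by positivity) (hk s)) Finset.univ_nonempty, ?_⟩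
  intro c hc hcε
  rw [lt_div_iff₀ (by positivity)] at hcε
  have hcP : 0 ≤ c * ∑ e, p e := mul_nonneg hc.le hP
  have hc1 : c ≤ 1 := by nlinarith
  have hcp : ∀ e, c * p e ≤ 1 / 2 := fun e => by
    have h1 : p e ≤ ∑ e, p e :=
      Finset.single_le_sum (f := p) (fun e _ => (hp e).le) (Finset.mem_univ e)
    nlinarith [mul_le_mul_of_nonneg_left h1 hc.le]
  have hcp0 : ∀ e, 0 < c * p e := fun e => mul_pos hc (hp e)
  have hterm : ∀ s, 0 ≤ (1/2 : ℝ) ^ m *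
      ∏ e, (c * p e) ^ h s e * (1 - c * p e) ^ (m - h s e) := fun s =>
    mul_nonneg (by positivity) (Finset.prod_nonneg fun e _ =>
      mul_nonneg (pow_nonneg (hcp0 e).le _) (pow_nonneg (by linarith [hcp e]) _))
  constructor
  · refine le_trans ?_ (Finset.single_le_sum (fun s _ => hterm s) (Finset.mem_univ s₀))
    rw [hs₀, mul_assoc, ← Finset.prod_pow_eq_pow_sum, ← Finset.prod_mul_distrib]
    refine mul_le_mul_of_nonneg_left (Finset.prod_le_prod (fun e _ => ?_) fun e _ => ?_)
      (by positivity)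
    · have := hp e
      positivity
    · have h2 : (1/2 : ℝ) ^ (m - h s₀ e) ≤ (1 - c * p e) ^ (m - h s₀ e) :=
        pow_le_pow_left₀ (by norm_num) (by linarith [hcp e]) _
      calc _ = (c * p e) ^ h s₀ e * (1/2 : ℝ) ^ (m - h s₀ e) := by rw [mul_pow]; ring
        _ ≤ _ := mul_le_mul_of_nonneg_left h2 (pow_nonneg (hcp0 e).le _)
  · rw [Finset.sum_mul]
    refine Finset.sum_le_sum fun s _ => ?_
    rw [mul_assoc]
    refine mul_le_mul_of_nonneg_left ?_ (by positivity)
    calc _ ≤ ∏ e, p e ^ h s e * c ^ h s e := by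
          refine Finset.prod_le_prod (fun e _ => mul_nonneg (pow_nonneg (hcp0 e).le _)
            (pow_nonneg (by linarith [hcp e]) _)) fun e _ => ?_
          rw [← mul_pow, mul_comm (p e) c]
          exact mul_le_of_le_one_right (pow_nonneg (hcp0 e).le _)
            (pow_le_one₀ (by linarith [hcp e]) (by linarith [hcp0 e]))
      _ = (∏ e, p e ^ h s e) * c ^ (∑ e, h s e) := by
          rw [Finset.prod_mul_distrib, Finset.prod_pow_eq_pow_sum]
      _ ≤ _ := mul_le_mul_of_nonneg_left (pow_le_pow_of_le_one hc.le hc1 (hle s)) (hk s).le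
end

section
/- Let m be a positive integer. For i = 1, 2 let E_i be a finite set, S_i a nonempty finite set, h_i : S_i × E_i → ℕ with h_i(s,e) ≤ m, p_i : E_i → ℝ with p_i(e) > 0 for all e, and define f_i(c) = ∑_{s∈S_i} 2^{−m} ∏_{e∈E_i} (c·p_i(e))^{h_i(s,e)} · (1 − c·p_i(e))^{m − h_i(s,e)} and L_i = min_{s∈S_i} ∑_{e∈E_i} h_i(s,e). If L_1 < L_2, then there exists ε > 0 such that f_1(c) > f_2(c) for all c with 0 < c < ε. -/
/-- Factor `c ^ L` out of the likelihood when `L` is at most every extension score. -/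
theorem likelihood_factor {E S : Type*} [Fintype E] [Fintype S] (m L : ℕ)
    (h : S → E → ℕ) (p : E → ℝ) (hL : ∀ s, L ≤ ∑ e, h s e) (c : ℝ) :
    (∑ s : S, (1/2 : ℝ) ^ m * ∏ e, (c * p e) ^ h s e * (1 - c * p e) ^ (m - h s e)) =
    c ^ L * ∑ s : S, (1/2 : ℝ) ^ m * (c ^ ((∑ e, h s e) - L) *
      ∏ e, p e ^ h s e * (1 - c * p e) ^ (m - h s e)) := by
  rw [Finset.mul_sum]
  refine Finset.sum_congr rfl fun s _ => ?_
  have h1 : c ^ L * c ^ ((∑ e, h s e) - L) = ∏ e, c ^ h s e := by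
    rw [← pow_add, Nat.add_sub_cancel' (hL s), Finset.prod_pow_eq_pow_sum]
  have h2 : ∏ e, (c * p e) ^ h s e * (1 - c * p e) ^ (m - h s e) =
      (∏ e, c ^ h s e) * ∏ e, p e ^ h s e * (1 - c * p e) ^ (m - h s e) := by
    rw [← Finset.prod_mul_distrib]
    exact Finset.prod_congr rfl fun e _ => by rw [mul_pow, mul_assoc]
  rw [h2, ← h1]
  ring

/-- For two trees under the Cavender–Farris model with likelihoods
`f_i c = ∑ s, 2^{-m} ∏ e, (c*p_i e)^{h_i s e} (1 - c*p_i e)^{m - h_i s e}`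
and parsimony scores `L_i = min_s ∑ e, h_i s e`: if `L₁ < L₂`, then there exists
`ε > 0` such that `f₁ c > f₂ c` for all `0 < c < ε`, regardless of the edge
probabilities. -/
theorem lower_parsimony_implies_higher_likelihood
    {E₁ S₁ E₂ S₂ : Type*} [Fintype E₁] [Fintype S₁] [Nonempty S₁]
    [Fintype E₂] [Fintype S₂] [Nonempty S₂]
    (m : ℕ) (hm : 0 < m)
    (h₁ : S₁ → E₁ → ℕ) (hh₁ : ∀ s e, h₁ s e ≤ m)
    (p₁ : E₁ → ℝ) (hp₁ : ∀ e, 0 < p₁ e)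
    (h₂ : S₂ → E₂ → ℕ) (hh₂ : ∀ s e, h₂ s e ≤ m)
    (p₂ : E₂ → ℝ) (hp₂ : ∀ e, 0 < p₂ e)
    (hL : (Finset.univ.inf' Finset.univ_nonempty fun s => ∑ e, h₁ s e) <
          (Finset.univ.inf' Finset.univ_nonempty fun s => ∑ e, h₂ s e)) :
    ∃ ε > (0:ℝ), ∀ c : ℝ, 0 < c → c < ε →
      (∑ s : S₂, (1/2 : ℝ) ^ m *
          ∏ e, (c * p₂ e) ^ h₂ s e * (1 - c * p₂ e) ^ (m - h₂ s e)) <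
      (∑ s : S₁, (1/2 : ℝ) ^ m *
          ∏ e, (c * p₁ e) ^ h₁ s e * (1 - c * p₁ e) ^ (m - h₁ s e)) := by
  obtain ⟨s₀, -, hs₀⟩ := Finset.exists_mem_eq_inf' (Finset.univ_nonempty (α := S₁))
    (fun s => ∑ e, h₁ s e)
  set L := Finset.univ.inf' Finset.univ_nonempty fun s => ∑ e, h₁ s e with hLdef
  have hL1 : ∀ s, L ≤ ∑ e, h₁ s e := fun s =>
    Finset.inf'_le (fun s => ∑ e, h₁ s e) (Finset.mem_univ s)
  have hL2 : ∀ s, L < ∑ e, h₂ s e := fun s =>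
    lt_of_lt_of_le hL (Finset.inf'_le (fun s => ∑ e, h₂ s e) (Finset.mem_univ s))
  let F₁ : ℝ → ℝ := fun c => ∑ s : S₁, (1/2 : ℝ) ^ m * (c ^ ((∑ e, h₁ s e) - L) *
      ∏ e, p₁ e ^ h₁ s e * (1 - c * p₁ e) ^ (m - h₁ s e))
  let F₂ : ℝ → ℝ := fun c => ∑ s : S₂, (1/2 : ℝ) ^ m * (c ^ ((∑ e, h₂ s e) - L) *
      ∏ e, p₂ e ^ h₂ s e * (1 - c * p₂ e) ^ (m - h₂ s e))
  have hF1 : Continuous F₁ := by fun_prop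
  have hF2 : Continuous F₂ := by fun_prop
  have h20 : F₂ 0 = 0 := by
    refine Finset.sum_eq_zero fun s _ => ?_
    rw [zero_pow (Nat.sub_pos_of_lt (hL2 s)).ne']
    simp
  have hprod : ∀ s, 0 < ∏ e, p₁ e ^ h₁ s e * (1 - 0 * p₁ e) ^ (m - h₁ s e) := fun s =>
    Finset.prod_pos fun e _ => by
      have := hp₁ e
      simp only [zero_mul, sub_zero, one_pow, mul_one]
      positivity
  have h10 : 0 < F₁ 0 := by
    refine Finset.sum_pos' (fun s _ => ?_) ⟨s₀, Finset.mem_univ _, ?_⟩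
    · have := hprod s
      positivity
    · have := hprod s₀
      have h0 : (∑ e, h₁ s₀ e) - L = 0 := by
        rw [hs₀]
        exact Nat.sub_self _
      rw [h0, pow_zero, one_mul]
      positivity
  have hev : ∀ᶠ c in nhds (0:ℝ), F₂ c < F₁ c :=
    hF2.continuousAt.eventually_lt hF1.continuousAt (by rw [h20]; exact h10)
  obtain ⟨ε, hε, hb⟩ := Metric.eventually_nhds_iff.mp hev
  refine ⟨ε, hε, fun c hc hcε => ?_⟩
  rw [likelihood_factor m L h₁ p₁ hL1 c, likelihood_factor m L h₂ p₂ (fun s => (hL2 s).le) c]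
  refine mul_lt_mul_of_pos_left (hb ?_) (pow_pos hc L)
  rw [Real.dist_eq, sub_zero, abs_of_pos hc]
  exact hcε
end

section
/- Let n ≥ 2 and m ≥ 1 be integers, let d ≥ 1 and c be real numbers with 0 < c, let E be a finite set with |E| = 2n − 2, let S be a nonempty finite set with |S| ≤ 2^{m(n−1)}, let h : S × E → ℕ satisfy h(s,e) ≤ m for all s and e, and let p : E → ℝ satisfy c < p(e), p(e) < 1/2, and p(e) < c·d for every e ∈ E. Define L = ∑_{s∈S} 2^{−m} ∏_{e∈E} p(e)^{h(s,e)} · (1 − p(e))^{m − h(s,e)} and l = min_{s∈S} ∑_{e∈E} h(s,e). Then 2^{−2mn} · c^{l} < L < 2^{mn} · d^{2mn} · c^{l}. -/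
/-- Bounds on the likelihood of a tree displayed by a network of height `d` in which
every edge has probability `c` (Cavender–Farris model). The tree has `n` leaves,
hence `|E| = 2n − 2` edges; `S` is a nonempty set of extensions with
`|S| ≤ 2^{m(n-1)}`; `h s e ≤ m` is the Hamming distance across edge `e` under
extension `s`; each edge probability satisfies `c < p e < min (c*d) (1/2)`.
With `L` the likelihood and `l` the parsimony score,
`2^{−2mn} · c^l < L < 2^{mn} · d^{2mn} · c^l`. -/
theorem likelihood_bounds {E S : Type*} [Fintype E] [Fintype S] [Nonempty S]
    (n m : ℕ) (hn : 2 ≤ n) (hm : 1 ≤ m)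
    (d c : ℝ) (hd : 1 ≤ d) (hc : 0 < c)
    (hE : Fintype.card E = 2 * n - 2)
    (hS : Fintype.card S ≤ 2 ^ (m * (n - 1)))
    (h : S → E → ℕ) (hh : ∀ s e, h s e ≤ m)
    (p : E → ℝ) (hp₁ : ∀ e, c < p e) (hp₂ : ∀ e, p e < 1/2) (hp₃ : ∀ e, p e < c * d) :
    ((2:ℝ) ^ (2 * m * n))⁻¹ *
        c ^ (Finset.univ.inf' Finset.univ_nonempty fun s => ∑ e, h s e) <
      (∑ s : S, (1/2 : ℝ) ^ m * ∏ e, (p e) ^ h s e * (1 - p e) ^ (m - h s e)) ∧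
    (∑ s : S, (1/2 : ℝ) ^ m * ∏ e, (p e) ^ h s e * (1 - p e) ^ (m - h s e)) <
      (2:ℝ) ^ (m * n) * d ^ (2 * m * n) *
        c ^ (Finset.univ.inf' Finset.univ_nonempty fun s => ∑ e, h s e) := by
  have hcE : (Finset.univ : Finset E).card = 2 * n - 2 := hE
  obtain ⟨s0, -, hs0⟩ := Finset.exists_mem_eq_inf' (Finset.univ_nonempty (α := S))
    (fun s => ∑ e, h s e)
  have hmin : ∀ s, Finset.univ.inf' Finset.univ_nonempty (fun s => ∑ e, h s e) ≤ ∑ e, h s e :=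
    fun s => Finset.inf'_le (fun s => ∑ e, h s e) (Finset.mem_univ s)
  have hpos : ∀ e, 0 < p e := fun e => hc.trans (hp₁ e)
  have hq : ∀ e, 0 < 1 - p e := fun e => by linarith [hp₂ e]
  have hd0 : 0 < d := by linarith
  have hc1 : c ≤ 1 := by
    have : 0 < Fintype.card E := by omega
    obtain ⟨e⟩ := Fintype.card_pos_iff.mp this
    linarith [hp₁ e, hp₂ e]
  have hnn : ∀ s, 0 ≤ (1/2 : ℝ) ^ m * ∏ e, (p e) ^ h s e * (1 - p e) ^ (m - h s e) := fun s =>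
    mul_nonneg (by positivity) (Finset.prod_nonneg fun e _ =>
      mul_nonneg (pow_nonneg (hpos e).le _) (pow_nonneg (hq e).le _))
  constructor
  · rw [hs0]
    have h1 : c ^ (∑ e, h s0 e) * ((1/2 : ℝ) ^ m) ^ (2 * n - 2) ≤
        ∏ e, (p e) ^ h s0 e * (1 - p e) ^ (m - h s0 e) := by
      rw [← Finset.prod_pow_eq_pow_sum, ← hcE, ← Finset.prod_const, ← Finset.prod_mul_distrib]
      refine Finset.prod_le_prod (fun e _ => by positivity) fun e _ => ?_
      refine mul_le_mul (pow_le_pow_left₀ hc.le (hp₁ e).le _) ?_ (by positivity)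
        (pow_nonneg (hpos e).le _)
      calc (1/2 : ℝ) ^ m ≤ (1/2 : ℝ) ^ (m - h s0 e) :=
            pow_le_pow_of_le_one (by norm_num) (by norm_num) (Nat.sub_le _ _)
        _ ≤ _ := pow_le_pow_left₀ (by norm_num) (by linarith [hp₂ e]) _
    have h2 := Finset.single_le_sum (fun s _ => hnn s) (Finset.mem_univ s0)
    refine lt_of_lt_of_le ?_ h2
    refine lt_of_lt_of_le ?_ (mul_le_mul_of_nonneg_left h1 (by positivity))
    have h3 : ((2:ℝ) ^ (2 * m * n))⁻¹ < (1/2 : ℝ) ^ m * ((1/2 : ℝ) ^ m) ^ (2 * n - 2) := by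
      rw [← pow_mul, ← pow_add, ← inv_pow, ← one_div]
      refine pow_lt_pow_right_of_lt_one₀ (by norm_num) (by norm_num) ?_
      obtain ⟨k, rfl⟩ := Nat.exists_eq_add_of_le hn
      have : 2 * (2 + k) - 2 = 2 * k + 2 := by omega
      rw [this]
      nlinarith
    calc _ < ((1/2 : ℝ) ^ m * ((1/2 : ℝ) ^ m) ^ (2 * n - 2)) * c ^ (∑ e, h s0 e) :=
          mul_lt_mul_of_pos_right h3 (by positivity)
      _ = _ := by ring
  · set l := Finset.univ.inf' Finset.univ_nonempty (fun s => ∑ e, h s e) with hl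
    have h1 : ∀ s, ∏ e, (p e) ^ h s e * (1 - p e) ^ (m - h s e) ≤ d ^ (2 * m * n) * c ^ l := by
      intro s
      calc ∏ e, (p e) ^ h s e * (1 - p e) ^ (m - h s e) ≤ ∏ e, c ^ h s e * d ^ m := by
            refine Finset.prod_le_prod (fun e _ =>
              mul_nonneg (pow_nonneg (hpos e).le _) (pow_nonneg (hq e).le _)) fun e _ => ?_
            calc (p e) ^ h s e * (1 - p e) ^ (m - h s e) ≤ (c * d) ^ h s e * 1 :=
                  mul_le_mul (pow_le_pow_left₀ (hpos e).le (hp₃ e).le _)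
                    (pow_le_one₀ (hq e).le (by linarith [hpos e]))
                    (pow_nonneg (hq e).le _) (by positivity)
              _ = c ^ h s e * d ^ h s e := by rw [mul_one, mul_pow]
              _ ≤ _ := mul_le_mul_of_nonneg_left (pow_le_pow_right₀ hd (hh s e)) (by positivity)
        _ = c ^ (∑ e, h s e) * (d ^ m) ^ (2 * n - 2) := by
            rw [Finset.prod_mul_distrib, Finset.prod_pow_eq_pow_sum, Finset.prod_const, hcE]
        _ ≤ c ^ l * d ^ (2 * m * n) := by
            refine mul_le_mul (pow_le_pow_of_le_one hc.le hc1 (hmin s)) ?_ (by positivity)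
              (by positivity)
            rw [← pow_mul]
            refine pow_le_pow_right₀ hd ?_
            calc m * (2 * n - 2) ≤ m * (2 * n) := Nat.mul_le_mul_left _ (Nat.sub_le _ _)
              _ = 2 * m * n := by ring
        _ = _ := mul_comm _ _
    have hX : 0 < d ^ (2 * m * n) * c ^ l := by positivity
    calc (∑ s : S, (1/2 : ℝ) ^ m * ∏ e, (p e) ^ h s e * (1 - p e) ^ (m - h s e))
        ≤ ∑ s : S, 1 * (d ^ (2 * m * n) * c ^ l) := by
          refine Finset.sum_le_sum fun s _ => ?_
          refine (mul_le_mul_of_nonneg_left (h1 s) (by positivity)).trans ?_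
          exact mul_le_mul_of_nonneg_right (pow_le_one₀ (by norm_num) (by norm_num)) hX.le
      _ = (Fintype.card S : ℝ) * (d ^ (2 * m * n) * c ^ l) := by
          simp
      _ < (2:ℝ) ^ (m * n) * (d ^ (2 * m * n) * c ^ l) := by
          refine mul_lt_mul_of_pos_right ?_ hX
          have h4 : (Fintype.card S : ℝ) ≤ 2 ^ (m * (n - 1)) := by exact_mod_cast hS
          refine h4.trans_lt (pow_lt_pow_right₀ (by norm_num) ?_)
          exact Nat.mul_lt_mul_of_pos_left (by omega) (by omega)
      _ = _ := by ring
end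

section
/- Let n ≥ 2 and m ≥ 1 be integers, d ≥ 1 a real number, and c a real number with 0 < c < d^{−2mn} · 2^{−3mn}. For i = 1, 2, let E_i be a finite set with |E_i| = 2n − 2, let S_i be a nonempty finite set with |S_i| ≤ 2^{m(n−1)}, let h_i : S_i × E_i → ℕ satisfy h_i(s,e) ≤ m, and let p_i : E_i → ℝ satisfy c < p_i(e), p_i(e) < 1/2, and p_i(e) < c·d for every e. Define L_i = ∑_{s∈S_i} 2^{−m} ∏_{e∈E_i} p_i(e)^{h_i(s,e)} · (1 − p_i(e))^{m − h_i(s,e)} and l_i = min_{s∈S_i} ∑_{e∈E_i} h_i(s,e). If l_1 < l_2, then L_1 > L_2. -/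
/-- In a network of height `d` whose edges all carry probability
`c` with `0 < c < d^{−2mn} · 2^{−3mn}` (Cavender–Farris model), a displayed tree
with strictly smaller parsimony score has strictly larger likelihood. Each tree
has `n` leaves and `2n − 2` edges indexed by `E_i`; `S_i` is a nonempty set of
extensions with `|S_i| ≤ 2^{m(n-1)}`; `h_i s e ≤ m` is the Hamming distance across
edge `e` under extension `s`; each edge probability satisfies
`c < p_i e < min (c*d) (1/2)`. If the parsimony scores satisfy `l₁ < l₂`, then the
likelihoods satisfy `L₁ > L₂`. -/
theorem most_likely_is_most_parsimonious
    {E₁ S₁ E₂ S₂ : Type*} [Fintype E₁] [Fintype S₁] [Nonempty S₁]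
    [Fintype E₂] [Fintype S₂] [Nonempty S₂]
    (n m : ℕ) (hn : 2 ≤ n) (hm : 1 ≤ m)
    (d c : ℝ) (hd : 1 ≤ d) (hc : 0 < c)
    (hc' : c < (d ^ (2 * m * n))⁻¹ * ((2:ℝ) ^ (3 * m * n))⁻¹)
    (hE₁ : Fintype.card E₁ = 2 * n - 2) (hS₁ : Fintype.card S₁ ≤ 2 ^ (m * (n - 1)))
    (h₁ : S₁ → E₁ → ℕ) (hh₁ : ∀ s e, h₁ s e ≤ m)
    (p₁ : E₁ → ℝ) (hp₁₁ : ∀ e, c < p₁ e) (hp₁₂ : ∀ e, p₁ e < 1/2)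
    (hp₁₃ : ∀ e, p₁ e < c * d)
    (hE₂ : Fintype.card E₂ = 2 * n - 2) (hS₂ : Fintype.card S₂ ≤ 2 ^ (m * (n - 1)))
    (h₂ : S₂ → E₂ → ℕ) (hh₂ : ∀ s e, h₂ s e ≤ m)
    (p₂ : E₂ → ℝ) (hp₂₁ : ∀ e, c < p₂ e) (hp₂₂ : ∀ e, p₂ e < 1/2)
    (hp₂₃ : ∀ e, p₂ e < c * d)
    (hl : (Finset.univ.inf' Finset.univ_nonempty fun s => ∑ e, h₁ s e) <
          (Finset.univ.inf' Finset.univ_nonempty fun s => ∑ e, h₂ s e)) :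
    (∑ s : S₂, (1/2 : ℝ) ^ m * ∏ e, (p₂ e) ^ h₂ s e * (1 - p₂ e) ^ (m - h₂ s e)) <
    (∑ s : S₁, (1/2 : ℝ) ^ m * ∏ e, (p₁ e) ^ h₁ s e * (1 - p₁ e) ^ (m - h₁ s e)) := by
  classical
  obtain ⟨s₀, -, hs₀⟩ := Finset.exists_mem_eq_inf' (s := (Finset.univ : Finset S₁))
    Finset.univ_nonempty (fun s => ∑ e, h₁ s e)
  have hlt : ∀ s, ∑ e, h₁ s₀ e < ∑ e, h₂ s e := by
    intro s
    rw [← hs₀]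
    exact lt_of_lt_of_le hl (Finset.inf'_le _ (Finset.mem_univ s))
  obtain ⟨k, rfl⟩ : ∃ k, n = k + 1 := ⟨n - 1, by omega⟩
  simp only [Nat.add_sub_cancel] at hS₂ hS₁
  have hE₁' : Fintype.card E₁ = 2 * k := by omega
  have hE₂' : Fintype.card E₂ = 2 * k := by omega
  generalize hl₀ : ∑ e, h₁ s₀ e = l at hlt
  have hd0 : 0 < d := by linarith
  have hcd : c * (d ^ (2 * (m * k)) * 2 ^ (3 * (m * k))) < 1 := by
    have h1 : d ^ (2 * (m * k)) ≤ d ^ (2 * m * (k + 1)) :=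
      pow_le_pow_right₀ hd (by nlinarith)
    have h2 : (2:ℝ) ^ (3 * (m * k)) ≤ 2 ^ (3 * m * (k + 1)) :=
      pow_le_pow_right₀ (by norm_num) (by nlinarith)
    rw [← mul_inv] at hc'
    calc _ ≤ c * (d ^ (2 * m * (k + 1)) * 2 ^ (3 * m * (k + 1))) := by gcongr
      _ < (d ^ (2 * m * (k + 1)) * 2 ^ (3 * m * (k + 1)))⁻¹ *
          (d ^ (2 * m * (k + 1)) * 2 ^ (3 * m * (k + 1))) := by gcongr
      _ = 1 := inv_mul_cancel₀ (by positivity)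
  have hc1 : c ≤ 1 := by
    have h1 : 1 ≤ d ^ (2 * (m * k)) := one_le_pow₀ hd
    have h2 : (1:ℝ) ≤ 2 ^ (3 * (m * k)) := one_le_pow₀ (by norm_num)
    nlinarith [one_le_mul_of_one_le_of_one_le h1 h2]
  have lower : c ^ l * (1/2) ^ (2 * (m * k)) ≤
      ∏ e, (p₁ e) ^ h₁ s₀ e * (1 - p₁ e) ^ (m - h₁ s₀ e) := by
    calc c ^ l * (1/2) ^ (2 * (m * k)) = ∏ e, (c ^ h₁ s₀ e * (1/2) ^ m) := by
          rw [Finset.prod_mul_distrib, Finset.prod_pow_eq_pow_sum, hl₀, Finset.prod_const,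
            Finset.card_univ, hE₁', ← pow_mul]
          congr 2; ring
      _ ≤ _ := by
          apply Finset.prod_le_prod
          · intro e _; positivity
          · intro e _
            have a := hp₁₁ e
            have b := hp₁₂ e
            have h3 : (1/2:ℝ) ^ m ≤ (1 - p₁ e) ^ (m - h₁ s₀ e) :=
              calc (1/2:ℝ) ^ m ≤ (1/2) ^ (m - h₁ s₀ e) :=
                    pow_le_pow_of_le_one (by norm_num) (by norm_num) (Nat.sub_le _ _)
                _ ≤ _ := pow_le_pow_left₀ (by norm_num) (by linarith) _
            have h4 := pow_le_pow_left₀ hc.le a.le (h₁ s₀ e)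
            exact mul_le_mul h4 h3 (by positivity) (pow_nonneg (by linarith) _)
  have upper : ∀ s, ∏ e, (p₂ e) ^ h₂ s e * (1 - p₂ e) ^ (m - h₂ s e) ≤
      c ^ (l + 1) * d ^ (2 * (m * k)) := by
    intro s
    have hH : ∑ e, h₂ s e ≤ 2 * (m * k) := by
      calc _ ≤ ∑ e : E₂, m := Finset.sum_le_sum fun e _ => hh₂ s e
        _ = _ := by rw [Finset.sum_const, Finset.card_univ, hE₂', smul_eq_mul]; ring
    calc _ ≤ ∏ e, (c * d) ^ h₂ s e := by
          apply Finset.prod_le_prod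
          · intro e _
            have a := hp₂₁ e
            have b := hp₂₂ e
            exact mul_nonneg (pow_nonneg (by linarith) _) (pow_nonneg (by linarith) _)
          · intro e _
            have a := hp₂₁ e
            have b := hp₂₂ e
            have h3 : (1 - p₂ e) ^ (m - h₂ s e) ≤ 1 :=
              pow_le_one₀ (by linarith) (by linarith)
            have h4 := pow_le_pow_left₀ (by linarith) (hp₂₃ e).le (h₂ s e)
            exact (mul_le_of_le_one_right (pow_nonneg (by linarith) _) h3).trans h4
      _ = c ^ (∑ e, h₂ s e) * d ^ (∑ e, h₂ s e) := by
          rw [Finset.prod_pow_eq_pow_sum, mul_pow]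
      _ ≤ _ := mul_le_mul (pow_le_pow_of_le_one hc.le hc1 (hlt s))
          (pow_le_pow_right₀ hd hH) (by positivity) (by positivity)
  rw [← Finset.mul_sum, ← Finset.mul_sum]
  apply mul_lt_mul_of_pos_left _ (by positivity)
  calc _ ≤ ∑ s : S₂, c ^ (l + 1) * d ^ (2 * (m * k)) := Finset.sum_le_sum fun s _ => upper s
    _ = (Fintype.card S₂ : ℝ) * (c ^ (l + 1) * d ^ (2 * (m * k))) := by
        rw [Finset.sum_const, Finset.card_univ, nsmul_eq_mul]
    _ ≤ 2 ^ (m * k) * (c ^ (l + 1) * d ^ (2 * (m * k))) := by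
        gcongr
        exact_mod_cast hS₂
    _ = (c ^ l * (1/2) ^ (2 * (m * k))) * (c * (d ^ (2 * (m * k)) * 2 ^ (3 * (m * k)))) := by
        have h5 : (1/2:ℝ) ^ (2 * (m * k)) * 2 ^ (3 * (m * k)) = 2 ^ (m * k) := by
          rw [show 3 * (m * k) = 2 * (m * k) + m * k by ring, pow_add, ← mul_assoc, ← mul_pow]
          norm_num
        rw [← h5]; ring
    _ < c ^ l * (1/2) ^ (2 * (m * k)) := mul_lt_of_lt_one_right (by positivity) hcd
    _ ≤ _ := lower
    _ ≤ _ := by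
        refine Finset.single_le_sum
          (f := fun s => ∏ e, (p₁ e) ^ h₁ s e * (1 - p₁ e) ^ (m - h₁ s e)) ?_ (Finset.mem_univ s₀)
        intro s _
        refine Finset.prod_nonneg fun e _ => ?_
        have a := hp₁₁ e
        have b := hp₁₂ e
        exact mul_nonneg (pow_nonneg (by linarith) _) (pow_nonneg (by linarith) _)
end
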